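/- Monotone Missing Data Pattern: There exist absolute constants c, C > 0 such that the following holds for all n ≥ 2, k ≥ 1, and ε ∈ (0,1]. Let A ∈ ℝ^{n×n} and let W ∈ {0,1}^{n×n} be any matrix in which each row consists of a prefix of ones followed by a suffix of zeros (i.e., for each i there is p_i ∈ {0,…,n} with W_{i,j} = 1 iff j ≤ p_i). Then for every k' ≥ k·(C·log n/ε)^c, every matrix L of rank at most k' satisfying ‖A ∘ W − L‖_F² ≤ (min over matrices L̂ of rank at most k' of ‖A ∘ W − L̂‖_F²) + ε·‖A ∘ W‖_F² also satisfies ‖(A − L) ∘ W‖_F² ≤ OPT + 2ε·‖A ∘ W‖_F² + ε·‖L_opt ∘ (1 − W)‖_F², where OPT = min over matrices L̂ of rank at most k of ‖(A − L̂) ∘ W‖_F² and L_opt is a rank-at-most-k matrix achieving OPT. -/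

import Mathlib

open Matrix BigOperators

/-- Squared Frobenius norm. -/
noncomputable def frob2 {n p : ℕ} (M : Matrix (Fin n) (Fin p) ℝ) : ℝ :=
  ∑ i, ∑ j, (M i j) ^ 2

/-- The entrywise complement `1 - W` of a binary matrix `W`. -/
def oneSub {n p : ℕ} (W : Matrix (Fin n) (Fin p) ℝ) : Matrix (Fin n) (Fin p) ℝ :=
  Matrix.of fun i j => 1 - W i j

/-- The polynomial over `ZMod q` whose coefficients are the binary digits of `x` in positions
strictly between `b` and `d`. -/
noncomputable def higherBitsPoly (q d b x : ℕ) : Polynomial (ZMod q) :=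
  ∑ i ∈ Finset.Ioo b d, Polynomial.monomial i (if x.testBit i then 1 else 0)

lemma higherBitsPoly_congr {q d b x y : ℕ}
    (h : ∀ i, b < i → i < d → x.testBit i = y.testBit i) :
    higherBitsPoly q d b x = higherBitsPoly q d b y := by
  refine Finset.sum_congr rfl fun i hi => ?_
  rw [Finset.mem_Ioo] at hi
  rw [h i hi.1 hi.2]

lemma coeff_higherBitsPoly {q d b x i : ℕ} (hb : b < i) (hd : i < d) :
    (higherBitsPoly q d b x).coeff i = if x.testBit i then 1 else 0 := by
  simp [higherBitsPoly, Polynomial.finsetSum_coeff, Polynomial.coeff_monomial, hb, hd]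

lemma natDegree_higherBitsPoly_le (q d b x : ℕ) : (higherBitsPoly q d b x).natDegree ≤ d := by
  refine Polynomial.natDegree_sum_le_of_forall_le _ _ fun i hi => ?_
  exact (Polynomial.natDegree_monomial_le _).trans (Finset.mem_Ioo.1 hi).2.le

/-- The number of points at which the higher-bit polynomials of `x` and `y` agree. -/
noncomputable def agreement (q d b x y : ℕ) [NeZero q] : ℕ :=
  (Finset.univ.filter fun a : ZMod q =>
    (higherBitsPoly q d b x).eval a = (higherBitsPoly q d b y).eval a).card

lemma agreement_of_forall_testBit_eq {q d b x y : ℕ} [NeZero q]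
    (h : ∀ i, b < i → i < d → x.testBit i = y.testBit i) : agreement q d b x y = q := by
  simp [agreement, higherBitsPoly_congr h, ZMod.card]

lemma agreement_le_of_testBit_ne {q d b x y i : ℕ} [Fact q.Prime] (hb : b < i) (hd : i < d)
    (h : x.testBit i ≠ y.testBit i) : agreement q d b x y ≤ d := by
  by_contra! hlt
  have h0 := Polynomial.eq_zero_of_natDegree_lt_card_of_eval_eq_zero'
    (higherBitsPoly q d b x - higherBitsPoly q d b y)
    (Finset.univ.filter fun a : ZMod q =>
      (higherBitsPoly q d b x).eval a = (higherBitsPoly q d b y).eval a)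
    (fun a ha => by
      rw [Polynomial.eval_sub, (Finset.mem_filter.1 ha).2, sub_self])
    (lt_of_le_of_lt ((Polynomial.natDegree_sub_le _ _).trans
      (max_le (natDegree_higherBitsPoly_le ..) (natDegree_higherBitsPoly_le ..))) hlt)
  have hc := congrArg (fun p => Polynomial.coeff p i) h0
  simp only [Polynomial.coeff_sub, coeff_higherBitsPoly hb hd, Polynomial.coeff_zero] at hc
  revert h hc
  cases x.testBit i <;> cases y.testBit i <;> simp

lemma exists_leading_testBit_of_lt {d x y : ℕ} (hx : x < 2 ^ d) (hyx : y < x) :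
    ∃ b < d, x.testBit b = true ∧ y.testBit b = false ∧
      ∀ i, b < i → i < d → x.testBit i = y.testBit i := by
  have hbit : ∀ z, z < 2 ^ d → ∀ i, d ≤ i → z.testBit i = false := fun z hz i hi =>
    Nat.testBit_lt_two_pow (hz.trans_le (Nat.pow_le_pow_right two_pos hi))
  have hne : ((Finset.range d).filter fun i => x.testBit i ≠ y.testBit i).Nonempty := by
    by_contra hemp
    rw [Finset.not_nonempty_iff_eq_empty, Finset.filter_eq_empty_iff] at hemp
    refine hyx.ne' (Nat.eq_of_testBit_eq fun i => ?_)
    by_cases hi : i < d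
    · simpa using hemp (Finset.mem_range.2 hi)
    · rw [hbit x hx i (by omega), hbit y (hyx.trans hx) i (by omega)]
  obtain ⟨b, hb, hmax⟩ := Finset.exists_max_image _ id hne
  rw [Finset.mem_filter, Finset.mem_range] at hb
  have hupper : ∀ i, b < i → i < d → x.testBit i = y.testBit i := by
    intro i hbi hid
    by_contra hi
    exact absurd (hmax i (Finset.mem_filter.2 ⟨Finset.mem_range.2 hid, hi⟩)) (by simpa using hbi)
  have hall : ∀ i, b < i → x.testBit i = y.testBit i := by
    intro i hbi
    by_cases hi : i < d
    · exact hupper i hbi hi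
    · rw [hbit x hx i (by omega), hbit y (hyx.trans hx) i (by omega)]
  refine ⟨b, hb.1, ?_⟩
  cases hxb : x.testBit b <;> cases hyb : y.testBit b
  · exact absurd (hxb.trans hyb.symm) hb.2
  · exact absurd (Nat.lt_of_testBit b hxb hyb hall) (by omega)
  · exact ⟨rfl, rfl, hupper⟩
  · exact absurd (hxb.trans hyb.symm) hb.2

lemma lt_of_leading_testBit {d b x y : ℕ} (hx : x < 2 ^ d) (hy : y < 2 ^ d)
    (hxb : x.testBit b = true) (hyb : y.testBit b = false)
    (h : ∀ i, b < i → i < d → x.testBit i = y.testBit i) : y < x := by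
  refine Nat.lt_of_testBit b hyb hxb fun i hi => ?_
  by_cases hid : i < d
  · exact (h i hi hid).symm
  · have hp : 2 ^ d ≤ 2 ^ i := Nat.pow_le_pow_right two_pos (by omega)
    rw [Nat.testBit_lt_two_pow (hx.trans_le hp), Nat.testBit_lt_two_pow (hy.trans_le hp)]

/-- The contribution of bit `b` to the approximate comparison of `y < x`. -/
noncomputable def bitComparison (q d x y : ℕ) [NeZero q] (b : ℕ) : ℝ :=
  if x.testBit b ∧ ¬ y.testBit b then (agreement q d b x y : ℝ) / q else 0

lemma bitComparison_nonneg (q d x y : ℕ) [NeZero q] (b : ℕ) : 0 ≤ bitComparison q d x y b := by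
  unfold bitComparison
  split_ifs <;> positivity

lemma bitComparison_le {q d x y b : ℕ} [Fact q.Prime]
    (h : x.testBit b = true → y.testBit b = false →
      ∃ i, b < i ∧ i < d ∧ x.testBit i ≠ y.testBit i) :
    bitComparison q d x y b ≤ (d : ℝ) / q := by
  unfold bitComparison
  split_ifs with hb
  · obtain ⟨i, hbi, hid, hi⟩ := h hb.1 (by simpa using hb.2)
    gcongr
    exact agreement_le_of_testBit_ne hbi hid hi
  · positivity

lemma sum_bitComparison_of_lt {q d x y : ℕ} [Fact q.Prime] (hx : x < 2 ^ d) (hyx : y < x) :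
    1 ≤ ∑ b ∈ Finset.range d, bitComparison q d x y b ∧
      ∑ b ∈ Finset.range d, bitComparison q d x y b ≤ 1 + d * (d / q) := by
  obtain ⟨b, hbd, hxb, hyb, hb⟩ := exists_leading_testBit_of_lt hx hyx
  have hq : (q : ℝ) ≠ 0 := Nat.cast_ne_zero.2 (Fact.out : q.Prime).ne_zero
  have hone : bitComparison q d x y b = 1 := by
    simp [bitComparison, hxb, hyb, agreement_of_forall_testBit_eq hb, hq]
  have hmem : b ∈ Finset.range d := Finset.mem_range.2 hbd
  constructor
  · rw [← hone]
    exact Finset.single_le_sum (fun i _ => bitComparison_nonneg q d x y i) hmem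
  · rw [← Finset.add_sum_erase _ _ hmem, hone]
    gcongr
    calc ∑ i ∈ (Finset.range d).erase b, bitComparison q d x y i
        ≤ ∑ _i ∈ (Finset.range d).erase b, (d : ℝ) / q := by
          refine Finset.sum_le_sum fun i hi => bitComparison_le fun hxi hyi => ?_
          rw [Finset.mem_erase, Finset.mem_range] at hi
          rcases lt_or_gt_of_ne hi.1 with hib | hbi
          · exact ⟨b, hib, hbd, by simp [hxb, hyb]⟩
          · exact absurd (hb i hbi hi.2) (by simp [hxi, hyi])
      _ ≤ ∑ _i ∈ Finset.range d, (d : ℝ) / q :=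
          Finset.sum_le_sum_of_subset_of_nonneg (Finset.erase_subset _ _)
            fun _ _ _ => by positivity
      _ = d * (d / q) := by simp

lemma sum_bitComparison_of_not_lt {q d x y : ℕ} [Fact q.Prime] (hx : x < 2 ^ d)
    (hy : y < 2 ^ d) (hyx : ¬ y < x) :
    ∑ b ∈ Finset.range d, bitComparison q d x y b ≤ d * (d / q) := by
  calc ∑ b ∈ Finset.range d, bitComparison q d x y b
      ≤ ∑ _b ∈ Finset.range d, (d : ℝ) / q := by
        refine Finset.sum_le_sum fun b _ => bitComparison_le fun hxb hyb => ?_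
        by_contra! h
        exact hyx (lt_of_leading_testBit hx hy hxb hyb h)
    _ = d * (d / q) := by simp

/-- The comparison kernel is a sum of `d * q ^ 2` products of a function of `x` and a function
of `y`. -/
lemma sum_bitComparison_eq (q d x y : ℕ) [NeZero q] :
    ∑ b ∈ Finset.range d, bitComparison q d x y b =
      ∑ s ∈ Finset.range d ×ˢ (Finset.univ : Finset (ZMod q × ZMod q)),
        (if x.testBit s.1 ∧ (higherBitsPoly q d s.1 x).eval s.2.1 = s.2.2
          then (1 : ℝ) / q else 0) *
        (if ¬ y.testBit s.1 ∧ (higherBitsPoly q d s.1 y).eval s.2.1 = s.2.2 then 1 else 0) := by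
  rw [Finset.sum_product]
  refine Finset.sum_congr rfl fun b _ => ?_
  rw [Fintype.sum_prod_type]
  unfold bitComparison agreement
  by_cases hx : x.testBit b = true
  swap
  · simp [hx]
  by_cases hy : y.testBit b = true
  · simp [hy]
  simp only [hx, hy, true_and, mul_ite, mul_one, mul_zero]
  rw [Finset.card_filter, Nat.cast_sum, div_eq_mul_inv, Finset.sum_mul]
  refine Finset.sum_congr rfl fun a _ => ?_
  split_ifs <;> simp_all

lemma rank_add_le {m n : Type*} [Fintype m] [Fintype n] (A B : Matrix m n ℝ) :
    (A + B).rank ≤ A.rank + B.rank := by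
  classical
  rw [Matrix.rank, Matrix.rank, Matrix.rank, Matrix.mulVecLin_add]
  exact (Submodule.finrank_mono (LinearMap.range_add_le _ _)).trans
    (Submodule.finrank_add_le_finrank_add_finrank _ _)

lemma rank_sum_le {ι m n : Type*} [Fintype m] [Fintype n] (s : Finset ι)
    (f : ι → Matrix m n ℝ) : (∑ i ∈ s, f i).rank ≤ ∑ i ∈ s, (f i).rank := by
  classical
  induction s using Finset.induction_on with
  | empty => simp
  | insert a s ha ih =>
    rw [Finset.sum_insert ha, Finset.sum_insert ha]
    exact (rank_add_le _ _).trans (by gcongr)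

/-- Multiplying entrywise by a sum of `#s` rank-one matrices increases the rank at most
`#s`-fold. -/
lemma rank_mul_sum_le {ι m n : Type*} [Fintype m] [Fintype n] [DecidableEq m] [DecidableEq n]
    (s : Finset ι) (u : ι → m → ℝ) (w : ι → n → ℝ) (M : Matrix m n ℝ) :
    (Matrix.of fun i j => (∑ t ∈ s, u t i * w t j) * M i j).rank ≤ s.card * M.rank := by
  have h : (Matrix.of fun i j => (∑ t ∈ s, u t i * w t j) * M i j) =
      ∑ t ∈ s, Matrix.diagonal (u t) * M * Matrix.diagonal (w t) := by
    ext i j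
    simp only [Matrix.of_apply, Matrix.sum_apply, Matrix.mul_diagonal, Matrix.diagonal_mul,
      Finset.sum_mul]
    exact Finset.sum_congr rfl fun t _ => by ring
  rw [h, ← smul_eq_mul]
  refine (rank_sum_le _ _).trans (Finset.sum_le_card_nsmul _ _ _ fun t _ => ?_)
  exact (Matrix.rank_mul_le_left _ _).trans (Matrix.rank_mul_le_right _ _)

lemma exists_prime_mul_div_le {d : ℕ} (hd : 0 < d) {ε : ℝ} (hε : 0 < ε) (hε1 : ε ≤ 1) :
    ∃ q : ℕ, q.Prime ∧ (d : ℝ) * (d / q) ≤ ε ∧ (q : ℝ) ≤ 4 * d ^ 2 / ε := by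
  have hd1 : (1 : ℝ) ≤ d := by exact_mod_cast hd
  have hpos : 0 < (d : ℝ) ^ 2 / ε := by positivity
  obtain ⟨q, hq, hlt, hle⟩ := Nat.exists_prime_lt_and_le_two_mul ⌈(d : ℝ) ^ 2 / ε⌉₊
    (Nat.ceil_pos.2 hpos).ne'
  have hq0 : (0 : ℝ) < q := by exact_mod_cast hq.pos
  refine ⟨q, hq, ?_, ?_⟩
  · have h : (d : ℝ) ^ 2 / ε ≤ q := (Nat.le_ceil _).trans (by exact_mod_cast hlt.le)
    rw [div_le_iff₀ hε] at h
    rw [← mul_div_assoc, div_le_iff₀ hq0]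
    linarith
  · have h1 : (q : ℝ) ≤ 2 * ⌈(d : ℝ) ^ 2 / ε⌉₊ := by exact_mod_cast hle
    have h2 := Nat.ceil_lt_add_one hpos.le
    have h3 : 1 ≤ (d : ℝ) ^ 2 / ε := by
      rw [le_div_iff₀ hε]
      nlinarith
    rw [mul_div_assoc]
    linarith

lemma sq_sub_mul_le {a l t ε : ℝ} (ht : 1 - ε ≤ t) (ht1 : t ≤ 1) (ht0 : 0 ≤ t) :
    (a - t * l) ^ 2 ≤ (a - l) ^ 2 + ε * a ^ 2 := by
  nlinarith [mul_nonneg (mul_nonneg ht0 (sub_nonneg.2 ht1)) (sq_nonneg l),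
    mul_nonneg (sub_nonneg.2 ht1) (sq_nonneg (a - l)),
    mul_nonneg (sub_nonneg.2 ht) (sq_nonneg a)]

/-- A low-rank matrix obtained from `M` by an entrywise approximation of the monotone mask `W`
approximates `A ∘ W` nearly as well as `M` does on the support of `W`. -/
lemma exists_lowRank_approx_of_monotone {n d q : ℕ} [Fact q.Prime]
    {A W M : Matrix (Fin n) (Fin n) ℝ}
    {ε : ℝ} (hn : n < 2 ^ d) (hε : 0 < ε) (hε1 : ε ≤ 1) (hdq : (d : ℝ) * (d / q) ≤ ε)
    (hW : ∀ i j, W i j = 0 ∨ W i j = 1)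
    (hmono : ∀ i : Fin n, ∃ p : ℕ, p ≤ n ∧ ∀ j : Fin n, (W i j = 1 ↔ (j : ℕ) < p)) :
    ∃ H : Matrix (Fin n) (Fin n) ℝ, H.rank ≤ d * q ^ 2 * M.rank ∧
      frob2 (Matrix.hadamard A W - H) ≤ frob2 (Matrix.hadamard (A - M) W)
        + ε * frob2 (Matrix.hadamard A W) + ε * frob2 (Matrix.hadamard M (oneSub W)) := by
  choose p hpn hp using hmono
  set T : Fin n → Fin n → ℝ := fun i j => ∑ b ∈ Finset.range d, bitComparison q d (p i) j b
    with hT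
  have hε' : 0 < 1 + ε := by linarith
  refine ⟨Matrix.of fun i j => T i j * ((1 + ε)⁻¹ * M i j), ?_, ?_⟩
  · have hr := rank_mul_sum_le (Finset.range d ×ˢ (Finset.univ : Finset (ZMod q × ZMod q)))
      (fun s (i : Fin n) => if (p i).testBit s.1 ∧
        (higherBitsPoly q d s.1 (p i)).eval s.2.1 = s.2.2 then (1 : ℝ) / q else 0)
      (fun s (j : Fin n) => if ¬ (j : ℕ).testBit s.1 ∧
        (higherBitsPoly q d s.1 j).eval s.2.1 = s.2.2 then 1 else 0)
      (Matrix.diagonal (fun _ => (1 + ε)⁻¹) * M)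
    simp only [← sum_bitComparison_eq, Matrix.diagonal_mul] at hr
    refine hr.trans ?_
    have hcard : (Finset.range d ×ˢ (Finset.univ : Finset (ZMod q × ZMod q))).card
        = d * q ^ 2 := by
      simp [Finset.card_product, ZMod.card, sq]
    rw [hcard]
    exact Nat.mul_le_mul_left _ (Matrix.rank_mul_le_right _ _)
  · simp only [frob2, Finset.mul_sum, ← Finset.sum_add_distrib]
    refine Finset.sum_le_sum fun i _ => Finset.sum_le_sum fun j _ => ?_
    simp only [Matrix.sub_apply, Matrix.hadamard_apply, Matrix.of_apply, oneSub]
    have hpi : p i < 2 ^ d := (hpn i).trans_lt hn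
    have hj : (j : ℕ) < 2 ^ d := j.2.trans hn
    have hassoc : T i j * ((1 + ε)⁻¹ * M i j) = T i j / (1 + ε) * M i j := by
      rw [div_eq_mul_inv]
      ring
    rw [hassoc]
    have hT0 : 0 ≤ T i j / (1 + ε) :=
      div_nonneg (Finset.sum_nonneg fun b _ => bitComparison_nonneg ..) hε'.le
    rcases hW i j with h0 | h1
    · have hlt : ¬ (j : ℕ) < p i := fun h => by simp [(hp i j).2 h] at h0
      have hTε : T i j ≤ ε := (sum_bitComparison_of_not_lt hpi hj hlt).trans hdq
      have ht : T i j / (1 + ε) ≤ ε := by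
        rw [div_le_iff₀ hε']
        nlinarith
      have hsq : (T i j / (1 + ε)) ^ 2 ≤ ε := by nlinarith
      rw [h0]
      nlinarith [mul_nonneg (sub_nonneg.2 hsq) (sq_nonneg (M i j))]
    · obtain ⟨hl, hu⟩ := sum_bitComparison_of_lt (q := q) hpi ((hp i j).1 h1)
      have ht1 : T i j / (1 + ε) ≤ 1 := by
        rw [div_le_one hε']
        exact hu.trans (by linarith)
      have ht : 1 - ε ≤ T i j / (1 + ε) := by
        rw [le_div_iff₀ hε']
        have : 1 ≤ T i j := hl
        nlinarith
      rw [h1]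
      simpa using sq_sub_mul_le (a := A i j) (l := M i j) ht ht1 hT0

lemma frob2_nonneg {n p : ℕ} (M : Matrix (Fin n) (Fin p) ℝ) : 0 ≤ frob2 M :=
  Finset.sum_nonneg fun _ _ => Finset.sum_nonneg fun _ _ => sq_nonneg _

lemma frob2_hadamard_sub_le {n p : ℕ} {A W L : Matrix (Fin n) (Fin p) ℝ}
    (hW : ∀ i j, W i j = 0 ∨ W i j = 1) :
    frob2 (Matrix.hadamard (A - L) W) ≤ frob2 (Matrix.hadamard A W - L) := by
  refine Finset.sum_le_sum fun i _ => Finset.sum_le_sum fun j _ => ?_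
  simp only [Matrix.sub_apply, Matrix.hadamard_apply]
  rcases hW i j with h | h <;> simp [h, sq_nonneg]

lemma mul_sq_mul_le {d q k : ℕ} {l ε : ℝ} (hd : (d : ℝ) ≤ 2 * l) (hε : 0 < ε) (hε1 : ε ≤ 1)
    (hq : (q : ℝ) ≤ 4 * d ^ 2 / ε) :
    (d : ℝ) * q ^ 2 * k ≤ k * (4 * l / ε) ^ 5 := by
  have hl : 0 ≤ l := by linarith [Nat.cast_nonneg (α := ℝ) d]
  calc (d : ℝ) * q ^ 2 * k ≤ d * (4 * d ^ 2 / ε) ^ 2 * k := by gcongr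
    _ = k * (16 * (d : ℝ) ^ 5) / ε ^ 2 := by field_simp; ring
    _ ≤ k * (16 * (2 * l) ^ 5) / ε ^ 2 := by gcongr
    _ = k * (512 * l ^ 5) / ε ^ 2 := by ring
    _ ≤ k * (1024 * l ^ 5) / ε ^ 5 := by
        have hpow : ε ^ 5 ≤ ε ^ 2 := pow_le_pow_of_le_one hε.le hε1 (by norm_num)
        gcongr
        norm_num
    _ = k * (4 * l / ε) ^ 5 := by field_simp; ring

/-- Monotone Missing Data Pattern. Each row of `W` is a prefix of
ones followed by a suffix of zeros; `log` is the base-2 logarithm. -/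
theorem stmt6 :
    ∃ c C : ℝ, 0 < c ∧ 0 < C ∧
      ∀ (n k k' : ℕ) (A W Lopt L : Matrix (Fin n) (Fin n) ℝ) (ε : ℝ),
        2 ≤ n → 1 ≤ k → 0 < ε → ε ≤ 1 →
        (∀ i j, W i j = 0 ∨ W i j = 1) →
        (∀ i : Fin n, ∃ pi : ℕ, pi ≤ n ∧ ∀ j : Fin n, (W i j = 1 ↔ (j : ℕ) < pi)) →
        (k : ℝ) * (C * Real.logb 2 (n : ℝ) / ε) ^ c ≤ (k' : ℝ) →
        Lopt.rank ≤ k →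
        (∀ M : Matrix (Fin n) (Fin n) ℝ, M.rank ≤ k →
          frob2 (Matrix.hadamard (A - Lopt) W) ≤ frob2 (Matrix.hadamard (A - M) W)) →
        L.rank ≤ k' →
        frob2 (Matrix.hadamard A W - L) ≤
          sInf {x : ℝ | ∃ M : Matrix (Fin n) (Fin n) ℝ, M.rank ≤ k' ∧
            x = frob2 (Matrix.hadamard A W - M)} + ε * frob2 (Matrix.hadamard A W) →
        frob2 (Matrix.hadamard (A - L) W) ≤
          frob2 (Matrix.hadamard (A - Lopt) W)
            + 2 * ε * frob2 (Matrix.hadamard A W)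
            + ε * frob2 (Matrix.hadamard Lopt (oneSub W)) := by
  refine ⟨5, 4, by norm_num, by norm_num, ?_⟩
  intro n k k' A W Lopt L ε hn _ hε hε1 hW hmono hk' hLopt _ _ hL
  obtain ⟨q, hq, hdq, hqle⟩ := exists_prime_mul_div_le (Nat.succ_pos (Nat.log 2 n)) hε hε1
  have : Fact q.Prime := ⟨hq⟩
  obtain ⟨H, hrank, hH⟩ := exists_lowRank_approx_of_monotone (A := A) (M := Lopt)
    (Nat.lt_pow_succ_log_self one_lt_two n) hε hε1 hdq hW hmono
  have hd : ((Nat.log 2 n).succ : ℝ) ≤ 2 * Real.logb 2 n := by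
    have h1 : (Nat.log 2 n : ℝ) ≤ Real.logb 2 n := by
      exact_mod_cast Real.natLog_le_logb n 2
    have h2 : (1 : ℝ) ≤ Nat.log 2 n := by
      exact_mod_cast Nat.log_pos one_lt_two hn
    push_cast
    linarith
  have hHk : H.rank ≤ k' := by
    refine hrank.trans ((Nat.mul_le_mul_left _ hLopt).trans ?_)
    have h := mul_sq_mul_le (k := k) hd hε hε1 hqle
    rw [show (5 : ℝ) = ((5 : ℕ) : ℝ) by norm_num, Real.rpow_natCast] at hk'
    exact_mod_cast h.trans hk'
  have hinf : sInf {x : ℝ | ∃ M : Matrix (Fin n) (Fin n) ℝ, M.rank ≤ k' ∧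
      x = frob2 (Matrix.hadamard A W - M)} ≤ frob2 (Matrix.hadamard A W - H) := by
    refine csInf_le ⟨0, ?_⟩ ⟨H, hHk, rfl⟩
    rintro _ ⟨M, _, rfl⟩
    exact frob2_nonneg _
  linarith [frob2_hadamard_sub_le (A := A) (L := L) hW]
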